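/- Let m, n ∈ ℕ and r, r₁, r₂, r', r'' ∈ ℝ satisfy r ≤ r₁ + min{0, r''} and r ≤ r₂ + min{0, r'}. Then there exists c > 0 (depending only on these indices) such that for all measurable sets A ⊆ ℝ^m and B ⊆ ℝ^n and all measurable functions F : ℝ^m → ℂ and G : ℝ^n → ℂ one has (∫∫_{A×B} ⟨(ξ,η)⟩^{2r} |F(ξ)|² |G(η)|² dξ dη)^{1/2} ≤ c · ( ‖⟨·⟩^{r'} F‖_{L²(ℝ^m)} · ‖⟨·⟩^{r₂} G‖_{L²(B)} + ‖⟨·⟩^{r₁} F‖_{L²(A)} · ‖⟨·⟩^{r''} G‖_{L²(ℝ^n)} ), with both sides interpreted in [0,∞]. -/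

import Mathlib

open scoped ENNReal
open MeasureTheory

/-- The Japanese bracket `⟨x⟩ = (1 + |x|²)^(1/2)`. -/
noncomputable def jb {E : Type*} [NormedAddCommGroup E] (x : E) : ℝ :=
  Real.sqrt (1 + ‖x‖ ^ 2)

/-- Concatenation of `ξ ∈ ℝ^m` and `η ∈ ℝ^n` into `(ξ, η) ∈ ℝ^(m+n)`. -/
noncomputable def concatE {m n : ℕ} (ξ : EuclideanSpace ℝ (Fin m))
    (η : EuclideanSpace ℝ (Fin n)) : EuclideanSpace ℝ (Fin (m + n)) :=
  (EuclideanSpace.equiv (Fin (m + n)) ℝ).symm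
    (Fin.append (fun i => ξ i) (fun j => η j))

theorem one_le_jb {E : Type*} [NormedAddCommGroup E] (x : E) : 1 ≤ jb x := by
  rw [jb, Real.one_le_sqrt]
  nlinarith [sq_nonneg ‖x‖]

theorem sq_jb {E : Type*} [NormedAddCommGroup E] (x : E) : jb x ^ 2 = 1 + ‖x‖ ^ 2 :=
  Real.sq_sqrt (by positivity)

theorem measurable_jb {E : Type*} [NormedAddCommGroup E] [MeasurableSpace E]
    [OpensMeasurableSpace E] : Measurable (jb : E → ℝ) := by
  unfold jb
  fun_prop

theorem sq_jb_concatE {m n : ℕ} (ξ : EuclideanSpace ℝ (Fin m)) (η : EuclideanSpace ℝ (Fin n)) :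
    jb (concatE ξ η) ^ 2 = jb ξ ^ 2 + jb η ^ 2 - 1 := by
  simp only [sq_jb, EuclideanSpace.norm_sq_eq]
  simp [concatE, Fin.sum_univ_add]
  ring

theorem rpow_le_mul_rpow_of_le {a b J p q s : ℝ} (ha : 1 ≤ a) (hab : a ≤ b) (hbJ : b ≤ J)
    (hJb : J ^ 2 ≤ 2 * b ^ 2) (h : p ≤ q + min 0 s) :
    J ^ (2 * p) ≤ 2 ^ |p| * (a ^ (2 * s) * b ^ (2 * q)) := by
  have hb : 1 ≤ b := ha.trans hab
  have ha0 : 0 < a := by linarith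
  have hb0 : 0 < b := by linarith
  have hJ0 : 0 < J := by linarith
  have hJp : J ^ (2 * p) ≤ 2 ^ |p| * b ^ (2 * p) := by
    rcases le_total 0 p with hp | hp
    · rw [abs_of_nonneg hp, Real.rpow_mul hJ0.le, Real.rpow_mul hb0.le,
        ← Real.mul_rpow (by norm_num) (by positivity)]
      exact Real.rpow_le_rpow (by positivity) (by simpa using hJb) hp
    · calc J ^ (2 * p) ≤ b ^ (2 * p) := Real.rpow_le_rpow_of_nonpos hb0 hbJ (by linarith)
        _ ≤ 2 ^ |p| * b ^ (2 * p) := le_mul_of_one_le_left (by positivity)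
          (Real.one_le_rpow (by norm_num) (abs_nonneg p))
  have hmin : b ^ (2 * min 0 s) ≤ a ^ (2 * s) := by
    rcases le_total 0 s with hs | hs
    · simpa [min_eq_left hs] using Real.one_le_rpow ha (by linarith : 0 ≤ 2 * s)
    · rw [min_eq_right hs]
      exact Real.rpow_le_rpow_of_nonpos ha0 hab (by linarith)
  refine hJp.trans (mul_le_mul_of_nonneg_left ?_ (by positivity))
  calc b ^ (2 * p) ≤ b ^ (2 * min 0 s + 2 * q) :=
        Real.rpow_le_rpow_of_exponent_le hb (by linarith)
    _ = b ^ (2 * min 0 s) * b ^ (2 * q) := Real.rpow_add hb0 _ _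
    _ ≤ a ^ (2 * s) * b ^ (2 * q) := mul_le_mul_of_nonneg_right hmin (by positivity)

theorem jb_concatE_rpow_le {m n : ℕ} {r r₁ r₂ r' r'' : ℝ}
    (h1 : r ≤ r₁ + min 0 r'') (h2 : r ≤ r₂ + min 0 r')
    (ξ : EuclideanSpace ℝ (Fin m)) (η : EuclideanSpace ℝ (Fin n)) :
    jb (concatE ξ η) ^ (2 * r) ≤
      2 ^ |r| * (jb ξ ^ (2 * r') * jb η ^ (2 * r₂) + jb ξ ^ (2 * r₁) * jb η ^ (2 * r'')) := by
  have hJ := sq_jb_concatE ξ η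
  have ha := one_le_jb ξ
  have hb := one_le_jb η
  have hc := one_le_jb (concatE ξ η)
  generalize jb (concatE ξ η) = J at *
  generalize jb ξ = a at *
  generalize jb η = b at *
  have haJ : a ≤ J := by nlinarith
  have hbJ : b ≤ J := by nlinarith
  rcases le_total a b with hab | hab
  · refine (rpow_le_mul_rpow_of_le ha hab hbJ (by nlinarith) h2).trans ?_
    gcongr
    exact le_add_of_nonneg_right (by positivity)
  · refine (rpow_le_mul_rpow_of_le hb hab haJ (by nlinarith) h1).trans ?_
    gcongr
    rw [mul_comm]
    exact le_add_of_nonneg_left (by positivity)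

theorem lintegral_lintegral_mul_add_mul {α β : Type*} [MeasurableSpace α] [MeasurableSpace β]
    {μ : Measure α} {ν : Measure β} {f₁ f₂ : α → ℝ≥0∞} {g₁ g₂ : β → ℝ≥0∞}
    (hf₁ : Measurable f₁) (hf₂ : Measurable f₂) (hg₁ : Measurable g₁) (hg₂ : Measurable g₂) :
    ∫⁻ x, ∫⁻ y, f₁ x * g₁ y + f₂ x * g₂ y ∂ν ∂μ =
      (∫⁻ x, f₁ x ∂μ) * (∫⁻ y, g₁ y ∂ν) + (∫⁻ x, f₂ x ∂μ) * (∫⁻ y, g₂ y ∂ν) := by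
  have hy (x : α) : ∫⁻ y, f₁ x * g₁ y + f₂ x * g₂ y ∂ν =
      f₁ x * (∫⁻ y, g₁ y ∂ν) + f₂ x * (∫⁻ y, g₂ y ∂ν) := by
    rw [lintegral_add_left (hg₁.const_mul _), lintegral_const_mul _ hg₁, lintegral_const_mul _ hg₂]
  simp_rw [hy]
  rw [lintegral_add_left (hf₁.mul_const _), lintegral_mul_const _ hf₁, lintegral_mul_const _ hf₂]

theorem measurable_ofReal_jb_rpow_mul {E : Type*} [NormedAddCommGroup E] [MeasurableSpace E]
    [OpensMeasurableSpace E] {F : E → ℂ} (hF : Measurable F) (s : ℝ) :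
    Measurable fun ξ => ENNReal.ofReal (jb ξ ^ s) * (‖F ξ‖₊ : ℝ≥0∞) ^ 2 := by
  have := measurable_jb (E := E)
  fun_prop

theorem stmt_10 (m n : ℕ) (r r₁ r₂ r' r'' : ℝ)
    (h1 : r ≤ r₁ + min 0 r'') (h2 : r ≤ r₂ + min 0 r') :
    ∃ c : ℝ, 0 < c ∧
      ∀ (A : Set (EuclideanSpace ℝ (Fin m))) (B : Set (EuclideanSpace ℝ (Fin n))),
        MeasurableSet A → MeasurableSet B →
      ∀ (F : EuclideanSpace ℝ (Fin m) → ℂ) (G : EuclideanSpace ℝ (Fin n) → ℂ),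
        Measurable F → Measurable G →
        (∫⁻ ξ in A, ∫⁻ η in B,
            ENNReal.ofReal (jb (concatE ξ η) ^ (2 * r)) * (‖F ξ‖₊ : ℝ≥0∞) ^ 2
              * (‖G η‖₊ : ℝ≥0∞) ^ 2) ^ (1 / 2 : ℝ)
          ≤ ENNReal.ofReal c *
            ((∫⁻ ξ, ENNReal.ofReal (jb ξ ^ (2 * r')) * (‖F ξ‖₊ : ℝ≥0∞) ^ 2) ^ (1 / 2 : ℝ)
                * (∫⁻ η in B, ENNReal.ofReal (jb η ^ (2 * r₂)) * (‖G η‖₊ : ℝ≥0∞) ^ 2) ^ (1 / 2 : ℝ)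
              + (∫⁻ ξ in A, ENNReal.ofReal (jb ξ ^ (2 * r₁)) * (‖F ξ‖₊ : ℝ≥0∞) ^ 2) ^ (1 / 2 : ℝ)
                * (∫⁻ η, ENNReal.ofReal (jb η ^ (2 * r'')) * (‖G η‖₊ : ℝ≥0∞) ^ 2) ^ (1 / 2 : ℝ)) := by
  refine ⟨(2 ^ |r|) ^ (1 / 2 : ℝ), by positivity, fun A B _ _ F G hF hG => ?_⟩
  have hpt (ξ : EuclideanSpace ℝ (Fin m)) (η : EuclideanSpace ℝ (Fin n)) :
      ENNReal.ofReal (jb (concatE ξ η) ^ (2 * r)) * (‖F ξ‖₊ : ℝ≥0∞) ^ 2 * (‖G η‖₊ : ℝ≥0∞) ^ 2 ≤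
        ENNReal.ofReal (2 ^ |r|) *
          ((ENNReal.ofReal (jb ξ ^ (2 * r')) * (‖F ξ‖₊ : ℝ≥0∞) ^ 2) *
              (ENNReal.ofReal (jb η ^ (2 * r₂)) * (‖G η‖₊ : ℝ≥0∞) ^ 2) +
            (ENNReal.ofReal (jb ξ ^ (2 * r₁)) * (‖F ξ‖₊ : ℝ≥0∞) ^ 2) *
              (ENNReal.ofReal (jb η ^ (2 * r'')) * (‖G η‖₊ : ℝ≥0∞) ^ 2)) := by
    have hξ : 0 ≤ jb ξ := zero_le_one.trans (one_le_jb ξ)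
    have hη : 0 ≤ jb η := zero_le_one.trans (one_le_jb η)
    have h := ENNReal.ofReal_le_ofReal (jb_concatE_rpow_le h1 h2 ξ η)
    rw [ENNReal.ofReal_mul (by positivity), ENNReal.ofReal_add (by positivity) (by positivity),
      ENNReal.ofReal_mul (by positivity), ENNReal.ofReal_mul (by positivity)] at h
    rw [mul_assoc]
    refine (mul_le_mul_left h _).trans_eq ?_
    ring
  have hint := lintegral_mono (μ := volume.restrict A) fun ξ =>
    lintegral_mono (μ := volume.restrict B) (hpt ξ)
  simp_rw [lintegral_const_mul' _ _ ENNReal.ofReal_ne_top] at hint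
  rw [lintegral_lintegral_mul_add_mul (measurable_ofReal_jb_rpow_mul hF _)
    (measurable_ofReal_jb_rpow_mul hF _) (measurable_ofReal_jb_rpow_mul hG _)
    (measurable_ofReal_jb_rpow_mul hG _)] at hint
  have hhalf : (0 : ℝ) ≤ 1 / 2 := by norm_num
  refine (ENNReal.rpow_le_rpow hint hhalf).trans ?_
  rw [ENNReal.mul_rpow_of_nonneg _ _ hhalf,
    ENNReal.ofReal_rpow_of_pos (by positivity : (0 : ℝ) < 2 ^ |r|)]
  gcongr
  refine (ENNReal.rpow_add_le_add_rpow _ _ hhalf (by norm_num)).trans ?_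
  rw [ENNReal.mul_rpow_of_nonneg _ _ hhalf, ENNReal.mul_rpow_of_nonneg _ _ hhalf]
  gcongr <;> exact Measure.restrict_le_self
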